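/- Let R be the quotient of the free (noncommutative) F₂-algebra on two generators u, v by the two-sided ideal generated by u³, v², u² + uv + vu, and uvu. Then: (i) R has exactly 32 elements; (ii) R is reversible (for all a, b ∈ R, ab = 0 implies ba = 0); and (iii) R is not left duo: the left ideal Rv of R is not a two-sided ideal (indeed v·(u+v) = vu does not lie in Rv). -/

import Mathlib

noncomputable def uGen : FreeAlgebra (ZMod 2) (Fin 2) := FreeAlgebra.ι (ZMod 2) 0

noncomputable def vGen : FreeAlgebra (ZMod 2) (Fin 2) := FreeAlgebra.ι (ZMod 2) 1

/-- The relations u³ = 0, v² = 0, u² + uv + vu = 0, uvu = 0; quotienting the free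
algebra by the ring congruence generated by these relations is the quotient by the
two-sided ideal generated by u³, v², u² + uv + vu, uvu. -/
inductive rel19 : FreeAlgebra (ZMod 2) (Fin 2) → FreeAlgebra (ZMod 2) (Fin 2) → Prop
  | ucube : rel19 (uGen * uGen * uGen) 0
  | vsq : rel19 (vGen * vGen) 0
  | mixed : rel19 (uGen * uGen + uGen * vGen + vGen * uGen) 0
  | uvu : rel19 (uGen * vGen * uGen) 0

/-- R = F₂⟨u,v⟩ / (u³, v², u² + uv + vu, uvu). -/
abbrev R19 : Type := RingQuot rel19

noncomputable def u19 : R19 := RingQuot.mkRingHom rel19 uGen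
noncomputable def v19 : R19 := RingQuot.mkRingHom rel19 vGen

@[ext] structure M19 where
  a : ZMod 2
  p : ZMod 2
  q : ZMod 2
  r : ZMod 2
  s : ZMod 2
deriving DecidableEq

namespace M19

def equivProd : M19 ≃ ZMod 2 × ZMod 2 × ZMod 2 × ZMod 2 × ZMod 2 where
  toFun x := (x.a, x.p, x.q, x.r, x.s)
  invFun x := ⟨x.1, x.2.1, x.2.2.1, x.2.2.2.1, x.2.2.2.2⟩
  left_inv _ := rfl
  right_inv _ := rfl

instance : Zero M19 := ⟨⟨0, 0, 0, 0, 0⟩⟩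
instance : One M19 := ⟨⟨1, 0, 0, 0, 0⟩⟩
instance : Add M19 := ⟨fun x y => ⟨x.a + y.a, x.p + y.p, x.q + y.q, x.r + y.r, x.s + y.s⟩⟩
instance : Neg M19 := ⟨fun x => ⟨-x.a, -x.p, -x.q, -x.r, -x.s⟩⟩
instance : Mul M19 := ⟨fun x y => ⟨x.a * y.a, x.a * y.p + x.p * y.a, x.a * y.q + x.q * y.a,
  x.a * y.r + x.r * y.a + x.p * y.p + x.p * y.q,
  x.a * y.s + x.s * y.a + x.p * y.p + x.q * y.p⟩⟩

theorem zero_def : (0 : M19) = ⟨0, 0, 0, 0, 0⟩ := rfl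
theorem one_def : (1 : M19) = ⟨1, 0, 0, 0, 0⟩ := rfl
theorem add_def (x y : M19) :
  x + y = ⟨x.a + y.a, x.p + y.p, x.q + y.q, x.r + y.r, x.s + y.s⟩ := rfl
theorem neg_def (x : M19) : -x = ⟨-x.a, -x.p, -x.q, -x.r, -x.s⟩ := rfl
theorem mul_def (x y : M19) : x * y = ⟨x.a * y.a, x.a * y.p + x.p * y.a, x.a * y.q + x.q * y.a,
  x.a * y.r + x.r * y.a + x.p * y.p + x.p * y.q,
  x.a * y.s + x.s * y.a + x.p * y.p + x.q * y.p⟩ := rfl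

instance : Ring M19 where
  add_assoc x y z := by ext <;> simp only [add_def] <;> ring
  zero_add x := by ext <;> simp only [add_def, zero_def] <;> ring
  add_zero x := by ext <;> simp only [add_def, zero_def] <;> ring
  add_comm x y := by ext <;> simp only [add_def] <;> ring
  neg_add_cancel x := by ext <;> simp only [add_def, neg_def, zero_def] <;> ring
  left_distrib x y z := by ext <;> simp only [add_def, mul_def] <;> ring
  right_distrib x y z := by ext <;> simp only [add_def, mul_def] <;> ring
  zero_mul x := by ext <;> simp only [mul_def, zero_def] <;> ring
  mul_zero x := by ext <;> simp only [mul_def, zero_def] <;> ring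
  mul_assoc x y z := by ext <;> simp only [mul_def] <;> ring
  one_mul x := by ext <;> simp only [mul_def, one_def] <;> ring
  mul_one x := by ext <;> simp only [mul_def, one_def] <;> ring
  nsmul := nsmulRec
  zsmul := zsmulRec

def scal : ZMod 2 →+* M19 where
  toFun c := ⟨c, 0, 0, 0, 0⟩
  map_one' := rfl
  map_zero' := rfl
  map_add' x y := by simp [add_def]
  map_mul' x y := by simp [mul_def]

instance : Algebra (ZMod 2) M19 := scal.toAlgebra' (by
  intro c x; ext <;> simp [scal, mul_def, mul_comm])

theorem algebraMap_def (c : ZMod 2) : algebraMap (ZMod 2) M19 c = ⟨c, 0, 0, 0, 0⟩ := rfl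

end M19

noncomputable def f19 : FreeAlgebra (ZMod 2) (Fin 2) →ₐ[ZMod 2] M19 :=
  FreeAlgebra.lift (ZMod 2) ![⟨0, 1, 0, 0, 0⟩, ⟨0, 0, 1, 0, 0⟩]

theorem f19_u : f19 uGen = ⟨0, 1, 0, 0, 0⟩ := by simp [f19, uGen]
theorem f19_v : f19 vGen = ⟨0, 0, 1, 0, 0⟩ := by simp [f19, vGen]

noncomputable def F19 : R19 →+* M19 :=
  RingQuot.lift ⟨(f19 : FreeAlgebra (ZMod 2) (Fin 2) →+* M19), by
    intro x y h
    cases h <;> simp only [RingHom.coe_coe, map_mul, map_add, map_zero, f19_u, f19_v] <;> decide⟩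

theorem F19_mk (x) : F19 (RingQuot.mkRingHom rel19 x) = f19 x := by
  simp [F19]
theorem F19_u : F19 u19 = ⟨0, 1, 0, 0, 0⟩ := by rw [u19, F19_mk, f19_u]
theorem F19_v : F19 v19 = ⟨0, 0, 1, 0, 0⟩ := by rw [v19, F19_mk, f19_v]

theorem mk_alg (c : ZMod 2) : RingQuot.mkRingHom rel19 (algebraMap _ _ c) = algebraMap _ R19 c := by
  rw [← RingQuot.mkAlgHom_coe (ZMod 2) rel19]
  exact (RingQuot.mkAlgHom (ZMod 2) rel19).commutes c

theorem F19_alg (c : ZMod 2) : F19 (algebraMap _ _ c) = ⟨c, 0, 0, 0, 0⟩ := by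
  rw [← mk_alg, F19_mk, AlgHom.commutes]; rfl

theorem two19 (x : R19) : x + x = 0 := by
  have h : (1 : R19) + 1 = 0 := by
    have := congrArg (algebraMap (ZMod 2) R19) (show (1 : ZMod 2) + 1 = 0 by decide)
    simpa only [map_add, map_one, map_zero] using this
  calc x + x = (1 + 1) * x := by rw [add_mul, one_mul]
    _ = 0 := by rw [h, zero_mul]

theorem uuu19 : u19 * u19 * u19 = 0 := by
  simpa [u19] using RingQuot.mkRingHom_rel rel19.ucube
theorem vv19 : v19 * v19 = 0 := by
  simpa [v19] using RingQuot.mkRingHom_rel rel19.vsq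
theorem mixed19 : u19 * u19 + u19 * v19 + v19 * u19 = 0 := by
  simpa [u19, v19] using RingQuot.mkRingHom_rel rel19.mixed
theorem uvu19 : u19 * v19 * u19 = 0 := by
  simpa [u19, v19] using RingQuot.mkRingHom_rel rel19.uvu
theorem uu19 : u19 * u19 = u19 * v19 + v19 * u19 := by
  have h := mixed19
  calc u19 * u19 = (u19 * u19 + u19 * v19 + v19 * u19) + (u19 * v19 + v19 * u19)
      - ((u19 * v19 + v19 * u19) + (u19 * v19 + v19 * u19)) := by abel
    _ = _ := by rw [h, two19]; abel
theorem vuv19 : v19 * u19 * v19 = 0 := by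
  have h := uuu19
  rw [mul_assoc, uu19, mul_add, ← mul_assoc, ← mul_assoc, uvu19, uu19, add_mul, mul_assoc u19, vv19] at h
  simpa using h

noncomputable def g19 (m : M19) : R19 :=
  m.a • (1 : R19) + m.p • u19 + m.q • v19 + m.r • (u19 * v19) + m.s • (v19 * u19)

theorem g19_add (x y : M19) : g19 (x + y) = g19 x + g19 y := by
  simp only [g19, M19.add_def]; module

theorem g19_mul (x y : M19) : g19 (x * y) = g19 x * g19 y := by
  have h1 : u19 * (u19 * v19) = 0 := by
    rw [← mul_assoc, uu19, add_mul, mul_assoc u19, vv19, vuv19]; simp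
  have h2 : u19 * (v19 * u19) = 0 := by rw [← mul_assoc, uvu19]
  have h3 : v19 * (u19 * v19) = 0 := by rw [← mul_assoc, vuv19]
  have h4 : v19 * (v19 * u19) = 0 := by rw [← mul_assoc, vv19, zero_mul]
  have h5 : u19 * v19 * v19 = 0 := by rw [mul_assoc, vv19, mul_zero]
  have h6 : v19 * u19 * u19 = 0 := by
    rw [mul_assoc, uu19, mul_add, h3, h4, add_zero]
  have k1 (z) : u19 * v19 * (u19 * z) = 0 := by rw [← mul_assoc, uvu19, zero_mul]
  have k2 (z) : u19 * v19 * (v19 * z) = 0 := by rw [← mul_assoc, h5, zero_mul]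
  have k3 (z) : v19 * u19 * (u19 * z) = 0 := by rw [← mul_assoc, h6, zero_mul]
  have k4 (z) : v19 * u19 * (v19 * z) = 0 := by rw [← mul_assoc, vuv19, zero_mul]
  simp only [g19, M19.mul_def, mul_add, add_mul, smul_mul_smul_comm, one_mul, mul_one,
    h1, h2, h3, h4, h5, h6, k1, k2, k3, k4, uu19, vv19, vuv19, uvu19, smul_zero, smul_add]
  module

theorem F19_smul (c : ZMod 2) (x : R19) : F19 (c • x) = ⟨c, 0, 0, 0, 0⟩ * F19 x := by
  rw [Algebra.smul_def, map_mul, F19_alg]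

theorem F19_g19 (m : M19) : F19 (g19 m) = m := by
  simp only [g19, map_add, F19_smul, map_mul, F19_u, F19_v, map_one]
  ext <;> simp [M19.add_def, M19.mul_def, M19.one_def]

theorem g19_F19 (x : R19) : g19 (F19 x) = x := by
  obtain ⟨x, rfl⟩ := RingQuot.mkRingHom_surjective rel19 x
  rw [F19_mk]
  induction x using FreeAlgebra.induction with
  | grade0 c => rw [AlgHom.commutes, mk_alg, M19.algebraMap_def]; simp [g19, Algebra.smul_def]
  | grade1 i =>
    fin_cases i
    · have := f19_u
      change g19 (f19 uGen) = u19
      rw [this]; simp [g19]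
    · have := f19_v
      change g19 (f19 vGen) = v19
      rw [this]; simp [g19]
  | mul a b ha hb => rw [map_mul, g19_mul, ha, hb, map_mul]
  | add a b ha hb => rw [map_add, g19_add, ha, hb, map_add]

theorem F19_inj : Function.Injective F19 := Function.LeftInverse.injective g19_F19

theorem M19.rev_aux : ∀ a p q a' p' q' : ZMod 2, a * a' = 0 → a * p' + p * a' = 0 →
    a * q' + q * a' = 0 → (a = 0 ∧ a' = 0) ∨ (a = 0 ∧ p = 0 ∧ q = 0) ∨ (a' = 0 ∧ p' = 0 ∧ q' = 0) := by
  have h01 : ∀ x : ZMod 2, x = 0 ∨ x = 1 := by decide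
  intro a p q a' p' q' h1 h2 h3
  rcases h01 a with rfl | rfl <;> rcases h01 a' with rfl | rfl <;> simp_all

theorem M19.rev_aux2 : ∀ p q p' q' : ZMod 2, p * p' + p * q' = 0 → p * p' + q * p' = 0 →
    p' * p + p' * q = 0 ∧ p' * p + q' * p = 0 := by decide

theorem M19.rev (x y : M19) (h : x * y = 0) : y * x = 0 := by
  obtain ⟨a, p, q, r, s⟩ := x
  obtain ⟨a', p', q', r', s'⟩ := y
  simp only [M19.mul_def, M19.zero_def, M19.mk.injEq] at h ⊢
  obtain ⟨h1, h2, h3, h4, h5⟩ := h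
  rcases M19.rev_aux _ _ _ _ _ _ h1 h2 h3 with ⟨rfl, rfl⟩ | ⟨rfl, rfl, rfl⟩ | ⟨rfl, rfl, rfl⟩
  · simp only [zero_mul, mul_zero, zero_add] at h4 h5
    simpa using M19.rev_aux2 _ _ _ _ h4 h5
  · simp_all [mul_comm]
  · simp_all [mul_comm]

/-- R = F₂⟨u,v⟩/(u³, v², u² + uv + vu, uvu) has 32 elements, is reversible, and is
not left duo: the left ideal Rv is not two-sided, since v·(u + v) ∉ Rv. -/
theorem R19_minimal_symmetric_nonduo :
    Nat.card R19 = 32 ∧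
    (∀ a b : R19, a * b = 0 → b * a = 0) ∧
    (v19 * (u19 + v19) ∉ Ideal.span {v19} ∧
      ¬ (∀ x ∈ Ideal.span {v19}, ∀ r : R19, x * r ∈ Ideal.span {v19})) := by
  have key : v19 * (u19 + v19) ∉ Ideal.span {v19} := by
    rw [Ideal.mem_span_singleton']
    rintro ⟨a, ha⟩
    have h := congrArg F19 ha
    simp only [map_mul, map_add, F19_u, F19_v, M19.mul_def, M19.add_def, M19.mk.injEq] at h
    have h5 := h.2.2.2.2
    simp at h5
  refine ⟨?_, ?_, key, fun h => key (h _ (Ideal.subset_span rfl) _)⟩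
  · have e : R19 ≃ M19 := ⟨F19, g19, g19_F19, F19_g19⟩
    rw [Nat.card_congr (e.trans M19.equivProd)]
    simp [Nat.card_prod]
  · intro a b h
    apply F19_inj
    rw [map_mul, map_zero]
    apply M19.rev
    rw [← map_mul, h, map_zero]
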